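/- Let h₁ and h₂ be traceless symmetric real 3×3 matrices, and set q_i(x) = xᵀh_i x (i = 1,2). Then the homogeneous quartic polynomial P(x) = q₁(x)q₂(x) − (2/7)‖x‖² xᵀ(h₁h₂ + h₂h₁)x + (2/35)tr(h₁h₂)‖x‖⁴ is harmonic (ΔP = 0), and the difference q₁(x)q₂(x) − P(x) is divisible by ‖x‖² in the polynomial ring ℝ[x₁,x₂,x₃]. Consequently P is the harmonic part of the product q₁q₂, i.e., P is the polynomial corresponding to the harmonic product h₁ ∗ h₂. -/

import Mathlib

open MvPolynomial

/-- The Laplacian of a polynomial in three variables. -/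
noncomputable def lap3 (p : MvPolynomial (Fin 3) ℝ) : MvPolynomial (Fin 3) ℝ :=
  ∑ i : Fin 3, pderiv i (pderiv i p)

/-- The polynomial `‖x‖² = x₁² + x₂² + x₃²`. -/
noncomputable def normSq3 : MvPolynomial (Fin 3) ℝ :=
  ∑ i : Fin 3, X i ^ 2

/-- The quadratic form `x ↦ xᵀ h x` of a 3×3 matrix `h`, as a polynomial. -/
noncomputable def quadForm3 (h : Matrix (Fin 3) (Fin 3) ℝ) : MvPolynomial (Fin 3) ℝ :=
  ∑ i : Fin 3, ∑ j : Fin 3, C (h i j) * X i * X j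

theorem lap3_mul (p q : MvPolynomial (Fin 3) ℝ) :
    lap3 (p * q) = lap3 p * q + 2 * ∑ i : Fin 3, pderiv i p * pderiv i q + p * lap3 q := by
  simp only [lap3, Fin.sum_univ_three, pderiv_mul, map_add]
  ring

theorem lap3_C_mul (a : ℝ) (p : MvPolynomial (Fin 3) ℝ) : lap3 (C a * p) = C a * lap3 p := by
  simp only [lap3, pderiv_C_mul, Finset.mul_sum]

theorem pderiv_normSq3 (k : Fin 3) : pderiv k normSq3 = 2 * X k := by
  fin_cases k <;>
    simp [normSq3, Fin.sum_univ_three, pow_two, pderiv_X] <;> ring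

theorem lap3_normSq3 : lap3 normSq3 = 6 := by
  have h (k : Fin 3) : pderiv k (2 * X k : MvPolynomial (Fin 3) ℝ) = 2 := by
    rw [two_mul, map_add, pderiv_X_self]; norm_num
  simp only [lap3, pderiv_normSq3, h, Fin.sum_univ_three]
  norm_num

theorem pderiv_quadForm3 (h : Matrix (Fin 3) (Fin 3) ℝ) (k : Fin 3) :
    pderiv k (quadForm3 h) = ∑ j : Fin 3, (C (h k j) + C (h j k)) * X j := by
  fin_cases k <;>
    simp [quadForm3, Fin.sum_univ_three, pderiv_X] <;> ring

theorem lap3_quadForm3 (h : Matrix (Fin 3) (Fin 3) ℝ) :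
    lap3 (quadForm3 h) = 2 * C h.trace := by
  simp [lap3, pderiv_quadForm3, Fin.sum_univ_three, pderiv_X, Pi.single_apply,
    Matrix.trace_fin_three]
  ring

theorem sum_X_mul_pderiv_quadForm3 (h : Matrix (Fin 3) (Fin 3) ℝ) :
    ∑ i : Fin 3, X i * pderiv i (quadForm3 h) = 2 * quadForm3 h := by
  simp only [pderiv_quadForm3]
  simp only [quadForm3, Fin.sum_univ_three]
  ring

theorem sum_pderiv_mul_pderiv_quadForm3 {h₁ h₂ : Matrix (Fin 3) (Fin 3) ℝ}
    (hs₁ : h₁.IsSymm) (hs₂ : h₂.IsSymm) :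
    ∑ i : Fin 3, pderiv i (quadForm3 h₁) * pderiv i (quadForm3 h₂) =
      2 * quadForm3 (h₁ * h₂ + h₂ * h₁) := by
  have e₁ (i j : Fin 3) : C (h₁ i j) + C (h₁ j i) = (2 * C (h₁ i j) : MvPolynomial (Fin 3) ℝ) := by
    rw [hs₁.apply i j, two_mul]
  have e₂ (i j : Fin 3) : C (h₂ i j) + C (h₂ j i) = (2 * C (h₂ i j) : MvPolynomial (Fin 3) ℝ) := by
    rw [hs₂.apply i j, two_mul]
  simp only [pderiv_quadForm3, e₁, e₂]
  simp only [quadForm3, Fin.sum_univ_three, Matrix.add_apply, Matrix.mul_apply, map_add, map_mul]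
  rw [hs₁.apply 0 1, hs₁.apply 0 2, hs₁.apply 1 2, hs₂.apply 0 1, hs₂.apply 0 2, hs₂.apply 1 2]
  ring

theorem lap3_normSq3_mul_quadForm3 (h : Matrix (Fin 3) (Fin 3) ℝ) :
    lap3 (normSq3 * quadForm3 h) = 14 * quadForm3 h + 2 * C h.trace * normSq3 := by
  rw [lap3_mul, lap3_normSq3, lap3_quadForm3]
  simp only [pderiv_normSq3, mul_assoc, ← Finset.mul_sum, sum_X_mul_pderiv_quadForm3]
  ring

theorem lap3_normSq3_sq : lap3 (normSq3 ^ 2) = 20 * normSq3 := by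
  rw [pow_two, lap3_mul, lap3_normSq3]
  simp only [pderiv_normSq3]
  simp only [normSq3, Fin.sum_univ_three]
  ring

theorem lap3_quadForm3_mul_quadForm3 {h₁ h₂ : Matrix (Fin 3) (Fin 3) ℝ}
    (hs₁ : h₁.IsSymm) (hs₂ : h₂.IsSymm) (ht₁ : h₁.trace = 0) (ht₂ : h₂.trace = 0) :
    lap3 (quadForm3 h₁ * quadForm3 h₂) = 4 * quadForm3 (h₁ * h₂ + h₂ * h₁) := by
  rw [lap3_mul, lap3_quadForm3, lap3_quadForm3, ht₁, ht₂,
    sum_pderiv_mul_pderiv_quadForm3 hs₁ hs₂, C_0]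
  ring

/-- **The harmonic product of two deviators.** For traceless symmetric `h₁, h₂`, the quartic
polynomial `P = q₁q₂ − (2/7)‖x‖² xᵀ(h₁h₂+h₂h₁)x + (2/35)tr(h₁h₂)‖x‖⁴` is harmonic, and
`q₁q₂ − P` is divisible by `‖x‖²`; hence `P` is the harmonic part of `q₁q₂`, i.e. the quartic
form of `h₁ ∗ h₂`. -/
theorem harmonic_product_deviators (h₁ h₂ : Matrix (Fin 3) (Fin 3) ℝ)
    (hs₁ : h₁.IsSymm) (hs₂ : h₂.IsSymm)
    (ht₁ : h₁.trace = 0) (ht₂ : h₂.trace = 0) :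
    lap3 (quadForm3 h₁ * quadForm3 h₂
        - C (2 / 7 : ℝ) * normSq3 * quadForm3 (h₁ * h₂ + h₂ * h₁)
        + C (2 / 35 * (h₁ * h₂).trace) * normSq3 ^ 2) = 0
    ∧ normSq3 ∣ quadForm3 h₁ * quadForm3 h₂ -
        (quadForm3 h₁ * quadForm3 h₂
          - C (2 / 7 : ℝ) * normSq3 * quadForm3 (h₁ * h₂ + h₂ * h₁)
          + C (2 / 35 * (h₁ * h₂).trace) * normSq3 ^ 2) := by
  constructor
  · have hlin (p q r : MvPolynomial (Fin 3) ℝ) :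
        lap3 (p - q + r) = lap3 p - lap3 q + lap3 r := by
      simp only [lap3, map_add, map_sub, Finset.sum_add_distrib, Finset.sum_sub_distrib]
    have htr : (h₁ * h₂ + h₂ * h₁).trace = 2 * (h₁ * h₂).trace := by
      rw [Matrix.trace_add, Matrix.trace_mul_comm h₂ h₁, two_mul]
    have hc₁ : (C (2 / 7 : ℝ) : MvPolynomial (Fin 3) ℝ) * 14 = 4 := by
      rw [← map_ofNat C 14, ← C_mul, ← map_ofNat C 4]
      norm_num
    have hc₂ : (C (2 / 35 : ℝ) : MvPolynomial (Fin 3) ℝ) * 20 = C (2 / 7 : ℝ) * 4 := by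
      rw [← map_ofNat C 20, ← map_ofNat C 4, ← C_mul, ← C_mul]
      norm_num
    rw [hlin, mul_assoc (C (2 / 7 : ℝ)), lap3_C_mul, lap3_C_mul,
      lap3_quadForm3_mul_quadForm3 hs₁ hs₂ ht₁ ht₂, lap3_normSq3_mul_quadForm3,
      lap3_normSq3_sq, htr, C_mul, C_mul, map_ofNat]
    linear_combination -quadForm3 (h₁ * h₂ + h₂ * h₁) * hc₁ + C (h₁ * h₂).trace * normSq3 * hc₂
  · exact ⟨C (2 / 7 : ℝ) * quadForm3 (h₁ * h₂ + h₂ * h₁)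
      - C (2 / 35 * (h₁ * h₂).trace) * normSq3, by ring⟩
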